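/- arXiv:2008.04539 — 2 statements merged into one kernel-verified Lean document; each statement's English description precedes it below -/
import Mathlib

section
/- Every nonrecursive set Turing reducible to a 2-generic set is of thin-free degree; in particular, every 2-generic set has thin-free Turing degree (it is not a member of any thin Π⁰₁ class, and no set of its degree is a member of a thin Π⁰₁ class). -/
/-- Finite binary strings. -/
abbrev BStr := List Bool

/-- The length-`k` initial segment of an infinite sequence, as a finite string. -/
def seg {α : Type} (A : ℕ → α) (k : ℕ) : List α := (List.range k).map A

/-- A Σ⁰₁ (r.e.) set of binary strings. -/
def Sigma01 (V : Set BStr) : Prop :=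
  ∃ f : BStr → ℕ → Bool, Computable₂ f ∧ ∀ σ, σ ∈ V ↔ ∃ n, f σ n = true

/-- A Σ⁰₂ set of binary strings. -/
def Sigma02 (V : Set BStr) : Prop :=
  ∃ f : BStr → ℕ × ℕ → Bool, Computable₂ f ∧ ∀ σ, σ ∈ V ↔ ∃ m, ∀ n, f σ (m, n) = true

/-- `A` meets the set of strings `V`. -/
def Meets (A : ℕ → Bool) (V : Set BStr) : Prop := ∃ k, seg A k ∈ V

/-- `A` avoids the set of strings `V`. -/
def Avoids (A : ℕ → Bool) (V : Set BStr) : Prop := ∃ k, ∀ τ, seg A k <+: τ → τ ∉ V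

/-- `A` is 1-generic. -/
def OneGeneric (A : ℕ → Bool) : Prop := ∀ V, Sigma01 V → Meets A V ∨ Avoids A V

/-- `A` is 2-generic. -/
def TwoGeneric (A : ℕ → Bool) : Prop := ∀ V, Sigma02 V → Meets A V ∨ Avoids A V

/-- A Turing functional: a computable, oracle-use-monotone map from finite oracle
strings to partial values. -/
structure Functional (α β : Type) [Primcodable α] [Primcodable β] where
  φ : List α → ℕ → Option β
  comp : Computable₂ φ
  mono : ∀ {σ τ : List α} {x : ℕ} {b : β}, σ <+: τ → φ σ x = some b → φ τ x = some b

/-- `Φ^A = B` (in particular `Φ^A` is total). -/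
def FunApplies {α β : Type} [Primcodable α] [Primcodable β]
    (Φ : Functional α β) (A : ℕ → α) (B : ℕ → β) : Prop :=
  ∀ x, ∃ k, Φ.φ (seg A k) x = some (B x)

/-- Turing reducibility `B ≤_T A`. -/
def TuringLE {α β : Type} [Primcodable α] [Primcodable β] (B : ℕ → β) (A : ℕ → α) : Prop :=
  ∃ Φ : Functional α β, FunApplies Φ A B

/-- Turing equivalence `B ≡_T A`. -/
def TuringEquiv {α β : Type} [Primcodable α] [Primcodable β] (B : ℕ → β) (A : ℕ → α) : Prop :=
  TuringLE B A ∧ TuringLE A B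

/-- A tree: a set of strings closed under initial segments. -/
def IsTree {α : Type} (T : Set (List α)) : Prop := ∀ σ τ : List α, σ <+: τ → τ ∈ T → σ ∈ T

/-- A recursive tree. -/
def RecTree {α : Type} [Primcodable α] (T : Set (List α)) : Prop :=
  IsTree T ∧ ∃ f : List α → Bool, Computable f ∧ ∀ σ, σ ∈ T ↔ f σ = true

/-- Every string on the tree has a proper extension on the tree. -/
def ExtendibleTree {α : Type} (T : Set (List α)) : Prop :=
  ∀ σ ∈ T, ∃ τ ∈ T, σ <+: τ ∧ σ ≠ τ

/-- The set `[T]` of infinite paths through the tree `T`. -/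
def paths {α : Type} (T : Set (List α)) : Set (ℕ → α) := {X | ∀ k, seg X k ∈ T}

/-- A clopen subset of the path space: a finite union of basic cylinders. -/
def ClopenC {α : Type} (N : Set (ℕ → α)) : Prop :=
  ∃ F : Finset (List α), N = {X | ∃ σ ∈ F, seg X σ.length = σ}

/-- A Π⁰₁ class: the set of paths through a recursive tree. -/
def Pi01C {α : Type} [Primcodable α] (P : Set (ℕ → α)) : Prop := ∃ T, RecTree T ∧ P = paths T

/-- A thin Π⁰₁ class: every Π⁰₁ subclass is the intersection with a clopen set. -/
def ThinPi01 {α : Type} [Primcodable α] (P : Set (ℕ → α)) : Prop :=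
  Pi01C P ∧ ∀ Q, Pi01C Q → Q ⊆ P → ∃ N, ClopenC N ∧ Q = P ∩ N

/-- `A` is of thin-free degree: no set Turing equivalent to `A` belongs to a thin Π⁰₁ class. -/
def ThinFreeDegree (A : ℕ → Bool) : Prop :=
  ∀ B : ℕ → Bool, TuringEquiv B A → ∀ P : Set (ℕ → Bool), ThinPi01 P → B ∉ P

open Classical in
/-- The halting problem `0′`. -/
noncomputable def K : ℕ → Bool := fun n =>
  if (Nat.Partrec.Code.eval (Denumerable.ofNat Nat.Partrec.Code n) n).Dom then true else false

/-- A recursive (limit-lemma) approximation of `A`. -/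
def RecApprox (σs : ℕ → BStr) (A : ℕ → Bool) : Prop :=
  Computable σs ∧ ∀ n, ∃ s0, ∀ s ≥ s0, (σs s).take n = seg A n

/-- `τ` is an initial segment of `A`. -/
def InitSegOf {α : Type} (τ : List α) (A : ℕ → α) : Prop := τ = seg A τ.length

/-- A recursively enumerable set of natural numbers. -/
def REset (S : Set ℕ) : Prop :=
  ∃ f : ℕ → ℕ → Bool, Computable₂ f ∧ ∀ s, s ∈ S ↔ ∃ n, f s n = true

/-- A Σ₁-correct approximation: every infinite r.e. set of stages contains a stage
whose approximating string is a true initial segment of `A`. -/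
def SigmaOneCorrect (σs : ℕ → BStr) (A : ℕ → Bool) : Prop :=
  ∀ S : Set ℕ, REset S → S.Infinite → ∃ s ∈ S, InitSegOf (σs s) A

/-- Total decoding of naturals. -/
def dcd (α : Type) [Primcodable α] [Inhabited α] (n : ℕ) : α := ((Encodable.decode n : Option α)).getD default

theorem dcd_encode {α : Type} [Primcodable α] [Inhabited α] (a : α) :
    dcd α (Encodable.encode a) = a := by
  simp [dcd]

theorem dcd_computable (α : Type) [Primcodable α] [Inhabited α] : Computable (dcd α) :=
  Primrec.option_getD.to_comp.comp Computable.decode (Computable.const default)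

theorem aux_search {α : Type} [Primcodable α] (p : α → ℕ → Bool) (hp : Computable₂ p)
    (h : ∀ a, ∃ n, p a n = true) : ∃ g : α → ℕ, Computable g ∧ ∀ a, p a (g a) = true := by
  have hr : Partrec fun a => Nat.rfind fun n => Part.some (p a n) := Partrec.rfind hp.partrec₂
  refine ⟨fun a => Nat.find (h a), hr.of_eq fun a => ?_, fun a => Nat.find_spec (h a)⟩
  refine Part.eq_some_iff.2 (Nat.mem_rfind.2 ?_)
  refine ⟨?_, fun {m} hm => ?_⟩
  · simpa using (Nat.find_spec (h a)).symm
  · have := Nat.find_min (h a) hm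
    simpa using this

theorem seg_succ {α : Type} (A : ℕ → α) (k : ℕ) : seg A (k+1) = seg A k ++ [A k] := by
  simp [seg, List.range_succ]

theorem seg_length {α : Type} (A : ℕ → α) (k : ℕ) : (seg A k).length = k := by
  simp [seg]

theorem seg_getElem? {α : Type} (A : ℕ → α) (k i : ℕ) (h : i < k) :
    (seg A k)[i]? = some (A i) := by
  simp [seg, h]

theorem seg_isPre {α : Type} (A : ℕ → α) {j k : ℕ} (h : j ≤ k) : seg A j <+: seg A k := by
  induction h with
  | refl => exact List.prefix_rfl
  | step _ ih => exact ih.trans (by rw [Nat.succ_eq_add_one, seg_succ]; exact List.prefix_append _ _)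

theorem seg_congr {α : Type} {A B : ℕ → α} {k : ℕ} (h : ∀ i < k, A i = B i) : seg A k = seg B k := by
  unfold seg
  apply List.map_congr_left
  intro i hi
  exact h i (List.mem_range.1 hi)

theorem seg_computable {α : Type} [Primcodable α] {A : ℕ → α} (hA : Computable A) :
    Computable (seg A) := by
  have h2 : Computable₂ fun (_ : ℕ) (q : ℕ × List α) => q.2 ++ [A q.1] := by
    have h1 : Computable fun z : ℕ × (ℕ × List α) => z.2.2 := Computable.snd.comp Computable.snd
    have h3 : Computable fun z : ℕ × (ℕ × List α) => A z.2.1 :=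
      hA.comp (Computable.fst.comp Computable.snd)
    exact (Computable.list_concat.comp h1 h3)
  refine (Computable.nat_rec (f := fun n : ℕ => n) (g := fun _ => ([] : List α)) Computable.id
    (Computable.const _) h2).of_eq fun n => ?_
  induction n with
  | zero => rfl
  | succ n ih => rw [seg_succ, ← ih]

theorem comp_le {B : ℕ → Bool} {C : ℕ → Bool} (hC : Computable C) (h : TuringLE B C) :
    Computable B := by
  obtain ⟨Ψ, hΨ⟩ := h
  have hv : Computable₂ fun x k => Ψ.φ (seg C k) x :=
    Ψ.comp.comp ((seg_computable hC).comp Computable.snd) Computable.fst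
  have hp : Computable₂ fun x k => (Ψ.φ (seg C k) x).isSome :=
    Primrec.option_isSome.to_comp.comp hv
  obtain ⟨g, hg, hs⟩ := aux_search _ hp (fun x => by
    obtain ⟨k, hk⟩ := hΨ x
    exact ⟨k, by simp [hk]⟩)
  have : Computable fun x => (Ψ.φ (seg C (g x)) x).getD false :=
    Primrec.option_getD.to_comp.comp (hv.comp Computable.id hg) (Computable.const false)
  refine this.of_eq fun x => ?_
  have h1 := hs x
  obtain ⟨k, hk⟩ := hΨ x
  obtain ⟨b, hb⟩ := Option.isSome_iff_exists.1 h1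
  have e1 := Ψ.mono (seg_isPre C (le_max_left k (g x))) hk
  have e2 := Ψ.mono (seg_isPre C (le_max_right k (g x))) hb
  rw [e1] at e2
  simp only [hb, Option.getD_some]
  exact (Option.some.inj e2).symm

/-- greedy initial segment computed -/
def greedy (φ : BStr → ℕ → Option Bool) (σ : BStr) : ℕ → BStr
  | 0 => []
  | n+1 => if (greedy φ σ n).length = n then greedy φ σ n ++ (φ σ n).toList else greedy φ σ n

theorem greedy_len (φ : BStr → ℕ → Option Bool) (σ : BStr) (n : ℕ) : (greedy φ σ n).length ≤ n := by
  induction n with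
  | zero => simp [greedy]
  | succ n ih =>
    rw [greedy]
    split
    · cases h : φ σ n <;> simp <;> omega
    · omega

theorem greedy_step (φ : BStr → ℕ → Option Bool) (σ : BStr) (n : ℕ) :
    greedy φ σ n <+: greedy φ σ (n+1) := by
  rw [greedy]
  split
  · exact List.prefix_append _ _
  · exact List.prefix_rfl

theorem greedy_le (φ : BStr → ℕ → Option Bool) (σ : BStr) {m n : ℕ} (h : m ≤ n) :
    greedy φ σ m <+: greedy φ σ n := by
  induction h with
  | refl => exact List.prefix_rfl
  | step _ ih => exact ih.trans (greedy_step _ _ _)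

theorem greedy_mono (Φ : Functional Bool Bool) {σ τ : BStr} (h : σ <+: τ) (n : ℕ) :
    greedy Φ.φ σ n <+: greedy Φ.φ τ n := by
  induction n with
  | zero => simp [greedy]
  | succ n ih =>
    by_cases hl : (greedy Φ.φ σ n).length = n
    · have he : greedy Φ.φ σ n = greedy Φ.φ τ n :=
        ih.eq_of_length_le (by have := greedy_len Φ.φ τ n; omega)
      rw [greedy, greedy, ← he, if_pos hl, if_pos hl]
      cases hb : Φ.φ σ n with
      | none => simp
      | some b => rw [Φ.mono h hb]
    · have : greedy Φ.φ σ (n+1) = greedy Φ.φ σ n := by rw [greedy, if_neg hl]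
      rw [this]
      exact ih.trans (greedy_step _ _ _)

theorem greedy_computable (Φ : Functional Bool Bool) : Computable₂ (greedy Φ.φ) := by
  have h2 : Computable₂ fun (p : BStr × ℕ) (q : ℕ × BStr) =>
      bif decide (q.2.length = q.1) then q.2 ++ (Φ.φ p.1 q.1).toList else q.2 := by
    have hl : Computable fun z : (BStr × ℕ) × (ℕ × BStr) => z.2.2 :=
      Computable.snd.comp Computable.snd
    have hn : Computable fun z : (BStr × ℕ) × (ℕ × BStr) => z.2.1 :=
      Computable.fst.comp Computable.snd
    have hφ : Computable fun z : (BStr × ℕ) × (ℕ × BStr) => Φ.φ z.1.1 z.2.1 :=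
      Φ.comp.comp (Computable.fst.comp Computable.fst) hn
    have hd : Computable fun z : (BStr × ℕ) × (ℕ × BStr) => decide (z.2.2.length = z.2.1) :=
      (Primrec.eq (α := ℕ)).decide.to_comp.comp (Computable.list_length.comp hl) hn
    have ht : Computable fun z : Option Bool => z.toList := by
      have : Primrec fun z : Option Bool => z.toList := Primrec.dom_finite _
      exact this.to_comp
    exact Computable.cond hd (Computable.list_append.comp hl (ht.comp hφ)) hl
  refine (Computable.nat_rec (f := fun p : BStr × ℕ => p.2) (g := fun _ => ([] : BStr))
    Computable.snd (Computable.const _) h2).of_eq fun p => ?_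
  obtain ⟨σ, n⟩ := p
  induction n with
  | zero => rfl
  | succ n ih =>
    simp only at ih ⊢
    rw [greedy, ← ih]
    by_cases hc : (greedy Φ.φ σ n).length = n
    · rw [ih, if_pos hc]; simp [hc]
    · rw [ih, if_neg hc]; simp [hc]

theorem fun_bound {Φ : Functional Bool Bool} {A B : ℕ → Bool} (h : FunApplies Φ A B) (k : ℕ) :
    ∃ m, ∀ m' ≥ m, ∀ i < k, Φ.φ (seg A m') i = some (B i) := by
  induction k with
  | zero => exact ⟨0, by simp⟩
  | succ k ih =>
    obtain ⟨m, hm⟩ := ih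
    obtain ⟨j, hj⟩ := h k
    refine ⟨max m j, fun m' hm' i hi => ?_⟩
    rcases Nat.lt_succ_iff_lt_or_eq.1 hi with h1 | h1
    · exact hm m' (le_trans (le_max_left _ _) hm') i h1
    · subst h1
      exact Φ.mono (seg_isPre A (le_trans (le_max_right _ _) hm')) hj

theorem greedy_eq {φ : BStr → ℕ → Option Bool} {σ : BStr} {B : ℕ → Bool} {k : ℕ}
    (h : ∀ i < k, φ σ i = some (B i)) : greedy φ σ k = seg B k := by
  induction k with
  | zero => rfl
  | succ k ih =>
    rw [greedy, ih (fun i hi => h i (by omega)), seg_succ, if_pos (seg_length _ _), h k (by omega)]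
    rfl

theorem turing_trans {A B C : ℕ → Bool} (h1 : TuringLE C B) (h2 : TuringLE B A) :
    TuringLE C A := by
  obtain ⟨Ψ, hΨ⟩ := h1
  obtain ⟨Φ, hΦ⟩ := h2
  refine ⟨⟨fun σ x => Ψ.φ (greedy Φ.φ σ σ.length) x, ?_, ?_⟩, ?_⟩
  · exact Ψ.comp.comp ((greedy_computable Φ).comp Computable.fst
      (Computable.list_length.comp Computable.fst)) Computable.snd
  · intro σ τ x b h hx
    exact Ψ.mono ((greedy_mono Φ h _).trans (greedy_le _ _ h.length_le)) hx
  · intro x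
    obtain ⟨k, hk⟩ := hΨ x
    obtain ⟨m, hm⟩ := fun_bound hΦ k
    refine ⟨max m k, ?_⟩
    have e := greedy_eq (hm (max m k) (le_max_left _ _))
    refine Ψ.mono ?_ hk
    rw [← e, seg_length]
    exact greedy_le _ _ (le_max_right _ _)

theorem build (Φ : Functional Bool Bool) (σ : BStr)
    (h : ∀ (μ : BStr) (x : ℕ), ∃ ν : BStr, (Φ.φ (σ ++ (μ ++ ν)) x).isSome = true) :
    ∃ X : ℕ → Bool, Computable X ∧ ∀ k, ∃ μ : BStr, ∀ i < k, Φ.φ (σ ++ μ) i = some (X i) := by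
  have hof : Computable fun n : ℕ => dcd BStr n := dcd_computable BStr
  have hc : Computable₂ fun (p : BStr × ℕ) (n : ℕ) => p.1 ++ dcd BStr n :=
    Computable.list_append.comp (Computable.fst.comp Computable.fst) (hof.comp Computable.snd)
  have hp : Computable₂ fun (p : BStr × ℕ) (n : ℕ) =>
      (Φ.φ (σ ++ (p.1 ++ dcd BStr n)) p.2).isSome :=
    Primrec.option_isSome.to_comp.comp (Φ.comp.comp
      (Computable.list_append.comp (Computable.const σ) hc)
      (Computable.snd.comp Computable.fst))
  obtain ⟨g, hg, hs⟩ := aux_search _ hp (fun p => by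
    obtain ⟨ν, hν⟩ := h p.1 p.2
    exact ⟨Encodable.encode ν, by simpa [dcd_encode] using hν⟩)
  let s : ℕ → BStr := fun n => Nat.rec [] (fun n l => l ++ dcd BStr (g (l, n))) n
  have hs0 : ∀ n, s (n+1) = s n ++ dcd BStr (g (s n, n)) := fun n => rfl
  have hsc : Computable s := by
    refine Computable.nat_rec (f := fun n : ℕ => n) (g := fun _ => ([] : BStr))
      (h := fun _ q => q.2 ++ dcd BStr (g (q.2, q.1))) Computable.id
      (Computable.const _) ?_
    have hl : Computable fun z : ℕ × (ℕ × BStr) => z.2.2 := Computable.snd.comp Computable.snd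
    have hn : Computable fun z : ℕ × (ℕ × BStr) => z.2.1 := Computable.fst.comp Computable.snd
    exact Computable.list_append.comp hl (hof.comp (hg.comp (hl.pair hn)))
  have hsome : ∀ n, (Φ.φ (σ ++ s (n+1)) n).isSome = true := fun n => hs (s n, n)
  have hmono : ∀ m n, m ≤ n → s m <+: s n := by
    intro m n hmn
    induction hmn with
    | refl => exact List.prefix_rfl
    | step _ ih => exact ih.trans (by rw [Nat.succ_eq_add_one, hs0]; exact List.prefix_append _ _)
  refine ⟨fun n => (Φ.φ (σ ++ s (n+1)) n).getD false, ?_, fun k => ⟨s k, fun i hi => ?_⟩⟩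
  · exact Primrec.option_getD.to_comp.comp (Φ.comp.comp (Computable.list_append.comp
      (Computable.const σ) (hsc.comp Computable.succ)) Computable.id) (Computable.const false)
  · obtain ⟨b, hb⟩ := Option.isSome_iff_exists.1 (hsome i)
    simp only [hb, Option.getD_some]
    exact Φ.mono ((List.prefix_append_right_inj σ).2 (hmono _ _ hi)) hb

theorem singleton_pi {X : ℕ → Bool} (hX : Computable X) : Pi01C ({X} : Set (ℕ → Bool)) := by
  refine ⟨{σ | σ = seg X σ.length}, ⟨?_, fun σ => decide (σ = seg X σ.length), ?_, by simp⟩, ?_⟩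
  · intro σ τ h hτ
    have h2 := seg_isPre X h.length_le
    rw [← (show τ = seg X τ.length from hτ)] at h2
    exact (List.prefix_of_prefix_length_le h h2 (by rw [seg_length])).eq_of_length
      (by rw [seg_length])
  · exact (Primrec.eq (α := BStr)).decide.to_comp.comp Computable.id
      ((seg_computable hX).comp Computable.list_length)
  · ext Y
    constructor
    · rintro rfl k
      simp [seg_length]
    · intro h
      funext i
      have := h (i+1)
      have h2 : seg Y (i+1) = seg X (i+1) := by simpa [seg_length] using this
      have h3 := seg_getElem? Y (i+1) i (by omega)
      rw [h2, seg_getElem? X (i+1) i (by omega)] at h3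
      exact (Option.some.inj h3).symm

theorem fun_unique {Φ : Functional Bool Bool} {A B : ℕ → Bool} (h : FunApplies Φ A B) {k x : ℕ}
    {b : Bool} (hb : Φ.φ (seg A k) x = some b) : b = B x := by
  obtain ⟨j, hj⟩ := h x
  have e1 := Φ.mono (seg_isPre A (le_max_left k j)) hb
  have e2 := Φ.mono (seg_isPre A (le_max_right k j)) hj
  rw [e1] at e2
  exact Option.some.inj e2

theorem prefix_ext {α : Type} {σ τ : List α} (h : σ <+: τ) : ∃ μ, τ = σ ++ μ := by
  obtain ⟨μ, rfl⟩ := h; exact ⟨μ, rfl⟩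

theorem main_aux {A C : ℕ → Bool} (hA : TwoGeneric A) (hC : TuringLE C A)
    (hn : ¬ Computable C) {P : Set (ℕ → Bool)} (hP : ThinPi01 P) : C ∉ P := by
  intro hCP
  obtain ⟨Φ, hΦ⟩ := hC
  obtain ⟨⟨T, ⟨-, f, hf, hfT⟩, rfl⟩, hthin⟩ := hP
  have hof : Computable fun n : ℕ => dcd BStr n := dcd_computable BStr
  -- totality
  let V1 : Set BStr := {σ | ∃ x, ∀ n : ℕ, (Φ.φ (σ ++ dcd BStr n) x).isSome = false}
  have hV1 : Sigma02 V1 := by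
    refine ⟨fun σ p => !(Φ.φ (σ ++ dcd BStr p.2) p.1).isSome, ?_, fun σ => ?_⟩
    · exact Primrec.not.to_comp.comp (Primrec.option_isSome.to_comp.comp (Φ.comp.comp
        (Computable.list_append.comp Computable.fst (hof.comp (Computable.snd.comp Computable.snd)))
        (Computable.fst.comp Computable.snd)))
    · simp [V1]
  obtain ⟨k1, hk1⟩ : Avoids A V1 := by
    refine (hA V1 hV1).resolve_left ?_
    rintro ⟨k, x, hk⟩
    obtain ⟨j, hj⟩ := hΦ x
    have e := Φ.mono (seg_isPre A (le_max_right k j)) hj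
    obtain ⟨μ, hμ⟩ := prefix_ext (seg_isPre A (le_max_left k j))
    have := hk (Encodable.encode μ)
    rw [dcd_encode, ← hμ, e] at this
    simp at this
  -- staying in the tree
  let V2 : Set BStr := {σ | ∃ m : ℕ, ∀ n : ℕ, f (dcd BStr m) = false ∧
    ((dcd BStr m).length ≤ n ∨ Φ.φ σ n = (dcd BStr m)[n]?)}
  have hV2 : Sigma02 V2 := by
    refine ⟨fun σ p => !(f (dcd BStr p.1)) &&
      (decide ((dcd BStr p.1).length ≤ p.2) ||
        decide (Φ.φ σ p.2 = (dcd BStr p.1)[p.2]?)), ?_, fun σ => ?_⟩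
    · have hρ : Computable fun z : BStr × (ℕ × ℕ) => dcd BStr z.2.1 :=
        hof.comp (Computable.fst.comp Computable.snd)
      have hn : Computable fun z : BStr × (ℕ × ℕ) => z.2.2 := Computable.snd.comp Computable.snd
      refine Primrec.and.to_comp.comp (Primrec.not.to_comp.comp (hf.comp hρ))
        (Primrec.or.to_comp.comp ?_ ?_)
      · exact Primrec.nat_le.decide.to_comp.comp (Computable.list_length.comp hρ) hn
      · exact (Primrec.eq (α := Option Bool)).decide.to_comp.comp
          (Φ.comp.comp Computable.fst hn) (Computable.list_getElem?.comp hρ hn)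
    · simp [V2]
  obtain ⟨k2, hk2⟩ : Avoids A V2 := by
    refine (hA V2 hV2).resolve_left ?_
    rintro ⟨k, m, hk⟩
    set ρ := dcd BStr m
    have e : ρ = seg C ρ.length := by
      apply List.ext_getElem (by rw [seg_length])
      intro i hi hi'
      have h1 := ((hk i).2).resolve_left (by omega)
      rw [List.getElem?_eq_getElem hi] at h1
      rw [fun_unique hΦ h1]
      simp [seg]
    have h2 := (hfT _).1 (hCP ρ.length)
    rw [← e, (hk 0).1] at h2
    simp at h2
  -- splitting
  let V3 : Set BStr := {σ | ∀ n : ℕ,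
    (Φ.φ (σ ++ (dcd (BStr × BStr × ℕ) n).1) (dcd (BStr × BStr × ℕ) n).2.2 = none ∨
      Φ.φ (σ ++ (dcd (BStr × BStr × ℕ) n).2.1) (dcd (BStr × BStr × ℕ) n).2.2 = none ∨
      Φ.φ (σ ++ (dcd (BStr × BStr × ℕ) n).1) (dcd (BStr × BStr × ℕ) n).2.2 =
        Φ.φ (σ ++ (dcd (BStr × BStr × ℕ) n).2.1) (dcd (BStr × BStr × ℕ) n).2.2)}
  have hV3 : Sigma02 V3 := by
    refine ⟨fun σ p =>
      (decide (Φ.φ (σ ++ (dcd (BStr × BStr × ℕ) p.2).1) (dcd (BStr × BStr × ℕ) p.2).2.2 = none) ||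
      (decide (Φ.φ (σ ++ (dcd (BStr × BStr × ℕ) p.2).2.1) (dcd (BStr × BStr × ℕ) p.2).2.2 = none) ||
      decide (Φ.φ (σ ++ (dcd (BStr × BStr × ℕ) p.2).1) (dcd (BStr × BStr × ℕ) p.2).2.2 =
        Φ.φ (σ ++ (dcd (BStr × BStr × ℕ) p.2).2.1) (dcd (BStr × BStr × ℕ) p.2).2.2))), ?_, fun σ => ?_⟩
    · have hd : Computable fun z : BStr × (ℕ × ℕ) => dcd (BStr × BStr × ℕ) z.2.2 :=
        (dcd_computable (BStr × BStr × ℕ)).comp (Computable.snd.comp Computable.snd)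
      have hx := Computable.snd.comp (Computable.snd.comp hd)
      have h1 := Φ.comp.comp (Computable.list_append.comp Computable.fst (Computable.fst.comp hd)) hx
      have h2 := Φ.comp.comp (Computable.list_append.comp Computable.fst
        (Computable.fst.comp (Computable.snd.comp hd))) hx
      have heq := (Primrec.eq (α := Option Bool)).decide.to_comp
      exact Primrec.or.to_comp.comp (heq.comp h1 (Computable.const none))
        (Primrec.or.to_comp.comp (heq.comp h2 (Computable.const none)) (heq.comp h1 h2))
    · simp only [V3, Bool.or_eq_true, decide_eq_true_eq, Set.mem_ofPred_eq, exists_const]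
  have hV3' : ∀ σ, (∀ μ ν x b c, Φ.φ (σ ++ μ) x = some b → Φ.φ (σ ++ ν) x = some c → b = c) ↔
      σ ∈ V3 := by
    intro σ
    constructor
    · intro h n
      generalize dcd (BStr × BStr × ℕ) n = p
      obtain ⟨μ, ν, x⟩ := p
      simp only
      cases hb : Φ.φ (σ ++ μ) x with
      | none => simp
      | some b =>
        cases hc : Φ.φ (σ ++ ν) x with
        | none => simp
        | some c => simp [h μ ν x b c hb hc]
    · intro h μ ν x b c hb hc
      have := h (Encodable.encode (μ, ν, x))
      rw [dcd_encode] at this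
      simpa [hb, hc] using this
  have htot : ∀ τ, seg A k1 <+: τ → ∀ (μ : BStr) (x : ℕ),
      ∃ ν : BStr, (Φ.φ (τ ++ (μ ++ ν)) x).isSome = true := by
    intro τ hτ μ x
    by_contra hcon
    push Not at hcon
    refine hk1 (τ ++ μ) (hτ.trans (List.prefix_append _ _)) ⟨x, fun n => ?_⟩
    rw [List.append_assoc]
    simpa using hcon (dcd BStr n)
  have hpath : ∀ τ, seg A k1 <+: τ → seg A k2 <+: τ → ∃ X : ℕ → Bool, Computable X ∧
      X ∈ paths T ∧ ∀ k, ∃ μ : BStr, ∀ i < k, Φ.φ (τ ++ μ) i = some (X i) := by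
    intro τ h1 h2
    obtain ⟨X, hX, hXs⟩ := build Φ τ (htot τ h1)
    refine ⟨X, hX, fun k => ?_, hXs⟩
    by_contra hcon
    obtain ⟨μ, hμ⟩ := hXs k
    refine hk2 (τ ++ μ) (h2.trans (List.prefix_append _ _)) ⟨Encodable.encode (seg X k), fun n => ?_⟩
    rw [dcd_encode, seg_length]
    constructor
    · by_contra hc
      exact hcon ((hfT _).2 (by simpa using hc))
    · by_cases hnk : k ≤ n
      · exact Or.inl hnk
      · right
        rw [hμ n (by omega), seg_getElem? _ _ _ (by omega)]
  rcases hA V3 hV3 with ⟨k, hk⟩ | ⟨k3, hk3⟩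
  · -- C is computable
    rw [← hV3'] at hk
    apply hn
    have hv : Computable₂ fun (x : ℕ) (n : ℕ) => Φ.φ (seg A k ++ dcd BStr n) x :=
      Φ.comp.comp (Computable.list_append.comp (Computable.const _) (hof.comp Computable.snd))
        Computable.fst
    have hex : ∀ x, ∃ μ, Φ.φ (seg A k ++ μ) x = some (C x) := by
      intro x
      obtain ⟨j, hj⟩ := hΦ x
      have e := Φ.mono (seg_isPre A (le_max_right k j)) hj
      obtain ⟨μ, hμ⟩ := prefix_ext (seg_isPre A (le_max_left k j))
      exact ⟨μ, by rw [← hμ, e]⟩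
    obtain ⟨g, hg, hs⟩ := aux_search
      (fun x n => (Φ.φ (seg A k ++ dcd BStr n) x).isSome) (Primrec.option_isSome.to_comp.comp hv) (fun x => by
      obtain ⟨μ, hμ⟩ := hex x
      exact ⟨Encodable.encode μ, by simp [dcd_encode, hμ]⟩)
    have : Computable fun x => (Φ.φ (seg A k ++ dcd BStr (g x)) x).getD false :=
      Primrec.option_getD.to_comp.comp (hv.comp Computable.id hg) (Computable.const false)
    refine this.of_eq fun x => ?_
    obtain ⟨b, hb⟩ := Option.isSome_iff_exists.1 (hs x)
    obtain ⟨μ, hμ⟩ := hex x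
    simp only [hb, Option.getD_some]
    exact hk _ _ _ _ _ hb hμ
  · set σ := seg A (max k1 (max k2 k3)) with hσ
    have p1 : seg A k1 <+: σ := seg_isPre A (by omega)
    have p2 : seg A k2 <+: σ := seg_isPre A (by omega)
    have p3 : seg A k3 <+: σ := seg_isPre A (by omega)
    obtain ⟨X, hX, hXT, hXs⟩ := hpath σ p1 p2
    obtain ⟨N, ⟨F, rfl⟩, hN⟩ := hthin {X} (singleton_pi hX) (by simpa using hXT)
    have hXN : X ∈ paths T ∩ {X | ∃ σ ∈ F, seg X σ.length = σ} := by rw [← hN]; rfl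
    obtain ⟨-, ρ, hρF, hρ⟩ := hXN
    obtain ⟨μ, hμ⟩ := hXs ρ.length
    have key : ∀ ν x b, Φ.φ ((σ ++ μ) ++ ν) x = some b → b = X x := by
      intro ν x b hb
      have q : σ <+: (σ ++ μ) ++ ν := by rw [List.append_assoc]; exact List.prefix_append _ _
      obtain ⟨Y, -, hYT, hYs⟩ := hpath ((σ ++ μ) ++ ν) (p1.trans q) (p2.trans q)
      have hval : ∀ i c, Φ.φ ((σ ++ μ) ++ ν) i = some c → c = Y i := by
        intro i c hc
        obtain ⟨κ, hκ⟩ := hYs (i+1)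
        have e := hκ i (by omega)
        rw [Φ.mono (List.prefix_append _ κ) hc] at e
        exact Option.some.inj e
      have hYX : Y ∈ ({X} : Set (ℕ → Bool)) := by
        rw [hN]
        refine ⟨hYT, ρ, hρF, ?_⟩
        rw [← hρ, seg_length]
        exact seg_congr fun i hi => (hval i _ (Φ.mono (List.prefix_append _ ν) (hμ i hi))).symm
      rw [hval x b hb, (show Y = X from hYX)]
    refine hk3 (σ ++ μ) (p3.trans (List.prefix_append _ _)) ((hV3' _).1 ?_)
    intro κ ν x b c hb hc
    rw [key _ _ _ hb, key _ _ _ hc]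

theorem generic_noncomp {A : ℕ → Bool} (hA : TwoGeneric A) : ¬ Computable A := by
  intro hc
  have hV : Sigma02 {σ : BStr | σ ≠ seg A σ.length} := by
    refine ⟨fun σ _ => !decide (σ = seg A σ.length), ?_, by simp⟩
    exact (Primrec.not.to_comp.comp ((Primrec.eq (α := BStr)).decide.to_comp.comp Computable.id
      ((seg_computable hc).comp Computable.list_length))).comp Computable.fst
  rcases hA _ hV with ⟨k, hk⟩ | ⟨k, hk⟩
  · exact hk (by rw [seg_length])
  · refine hk (seg A k ++ [!A k]) (List.prefix_append _ _) ?_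
    intro h
    rw [List.length_append, seg_length] at h
    simp [seg_succ] at h

theorem turing_refl (A : ℕ → Bool) : TuringLE A A := by
  refine ⟨⟨fun σ x => σ[x]?, Computable.list_getElem?, ?_⟩, fun x => ⟨x+1, ?_⟩⟩
  · rintro σ τ x b ⟨μ, rfl⟩ h
    obtain ⟨hx, -⟩ := List.getElem?_eq_some_iff.1 h
    rw [List.getElem?_append_left hx, h]
  · exact seg_getElem? A _ _ (by omega)

theorem part_one (A B : ℕ → Bool) (hA : TwoGeneric A) (hB : TuringLE B A) (hn : ¬ Computable B) :
    ThinFreeDegree B := fun _ hC _ hP =>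
  main_aux hA (turing_trans hC.1 hB) (fun h => hn (comp_le h hC.2)) hP

/-- every nonrecursive set Turing below a 2-generic set is of thin-free
degree; in particular, every 2-generic set is of thin-free degree. -/
theorem two_generic_thin_free :
    (∀ A B : ℕ → Bool, TwoGeneric A → TuringLE B A → ¬ Computable B → ThinFreeDegree B) ∧
    (∀ A : ℕ → Bool, TwoGeneric A → ThinFreeDegree A) := by
  exact ⟨part_one, fun A hA => part_one A A hA (turing_refl A) (generic_noncomp hA)⟩
end

section
/- The tree T constructed from a Σ₁-correct approximation of a 1-generic set A <_T 0′ is recursive, every string of T is extendible, [T] is infinite, and T has a unique path C containing infinitely many non-B symbols; this path satisfies C^d = A (the sequence obtained from C by deleting all B symbols equals A), and C ≡_T A. -/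
/-- The three-letter alphabet `{0,1,B}`: `none` is the blank symbol `B`. -/
abbrev Sym3 := Option Bool

/-- Delete all blanks `B` from a string over `{0,1,B}`. -/
def delB (τ : List Sym3) : BStr := τ.filterMap id

/-- The level-marker function `l(s)` of the construction:
`l(0)=0`, `l(1)=|σ_0|+1`, `l(s+2)=l(s+1)+|σ_{s+1}|-|σ_s|`. -/
def lvl (σs : ℕ → BStr) : ℕ → ℕ
  | 0 => 0
  | 1 => (σs 0).length + 1
  | (s+2) => lvl σs (s+1) + ((σs (s+1)).length - (σs s).length)

/-- The stage during which level `n` of the tree is constructed: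
the `s` with `l(s) ≤ n < l(s+1)`. -/
def stg (σs : ℕ → BStr) (n : ℕ) : ℕ :=
  ((List.range (n + 2)).filter (fun s => lvl σs (s + 1) ≤ n)).length

/-- The tree `T ⊆ {0,1,B}^{<ω}` constructed from the approximation `(σ_s)`:
a string `τ` at a level built during stage `s` whose `B`-deleted part is an
initial segment of `σ_s` gets both children `0` and `1`; all other strings are
extended only by the blank `B`. -/
inductive TreeT (σs : ℕ → BStr) : List Sym3 → Prop
  | nil : TreeT σs []
  | ext (τ : List Sym3) (a : Sym3) : TreeT σs τ →
      (if delB τ <+: σs (stg σs τ.length) then a ≠ none else a = none) →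
      TreeT σs (τ ++ [a])

namespace TreeAux

theorem seg_succ {α : Type} (X : ℕ → α) (n : ℕ) : seg X (n + 1) = seg X n ++ [X n] := by
  simp [seg, List.range_succ]

theorem seg_length {α : Type} (X : ℕ → α) (n : ℕ) : (seg X n).length = n := by
  simp [seg]

theorem seg_getElem? {α : Type} (X : ℕ → α) {n i : ℕ} (h : i < n) :
    (seg X n)[i]? = some (X i) := by
  simp [seg, h]

theorem seg_pre_le {α : Type} (X : ℕ → α) {m n : ℕ} (h : m ≤ n) : seg X m <+: seg X n := by
  induction n, h using Nat.le_induction with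
  | base => exact List.prefix_rfl
  | succ n _ ih => rw [seg_succ]; exact ih.trans (List.prefix_append _ _)

theorem init_of_pre_le {α : Type} {X : ℕ → α} {ρ τ : List α} (h : ρ <+: τ)
    (hτ : τ = seg X τ.length) : ρ = seg X ρ.length := by
  have h1 : seg X ρ.length <+: τ := by
    rw [hτ]; exact seg_pre_le X h.length_le
  have := List.prefix_of_prefix_length_le h h1 (by rw [seg_length])
  exact this.eq_of_length (by rw [seg_length])

theorem delB_append (τ ρ : List Sym3) : delB (τ ++ ρ) = delB τ ++ delB ρ := by
  simp [delB]

theorem delB_none : delB [none] = [] := rfl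

theorem delB_some (b : Bool) : delB [some b] = [b] := rfl

theorem delB_length_le (τ : List Sym3) : (delB τ).length ≤ τ.length :=
  List.length_filterMap_le _ _

theorem delB_pre_le {τ ρ : List Sym3} (h : τ <+: ρ) : delB τ <+: delB ρ := by
  obtain ⟨t, rfl⟩ := h
  rw [delB_append]; exact List.prefix_append _ _

theorem lvl_succ (σs : ℕ → BStr) (hinc : ∀ s, (σs s).length < (σs (s + 1)).length) (s : ℕ) :
    lvl σs (s + 1) = (σs s).length + 1 := by
  induction s with
  | zero => rfl
  | succ s ih =>
    rw [lvl, ih]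
    have := hinc s
    omega

theorem stg_eq (σs : ℕ → BStr) (hinc : ∀ s, (σs s).length < (σs (s + 1)).length) (n : ℕ) :
    stg σs n = Nat.count (fun s => (σs s).length + 1 ≤ n) (n + 2) := by
  rw [stg, Nat.count, List.countP_eq_length_filter]
  simp only [lvl_succ σs hinc]

theorem stg_spec (σs : ℕ → BStr) (hinc : ∀ s, (σs s).length < (σs (s + 1)).length) (n s : ℕ) :
    s < stg σs n ↔ (σs s).length < n := by
  have hm : StrictMono (fun s => (σs s).length) := strictMono_nat_of_lt_succ hinc
  have hex : ∃ s, n ≤ (σs s).length := ⟨n, hm.id_le n⟩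
  have hf : ∀ s, s < Nat.find hex ↔ (σs s).length < n := by
    intro s
    rw [Nat.lt_find_iff]
    constructor
    · intro h; have := h s le_rfl; omega
    · intro h k hk
      have : (σs k).length ≤ (σs s).length := hm.monotone hk
      omega
  have key : ∀ N, Nat.count (fun s => (σs s).length + 1 ≤ n) N = min N (Nat.find hex) := by
    intro N
    induction N with
    | zero => simp
    | succ N ih =>
      rw [Nat.count_succ, ih]
      have := hf N
      split_ifs with h <;> omega
  have hle : Nat.find hex ≤ n := Nat.find_min' hex (hm.id_le n)
  rw [← hf s, stg_eq σs hinc, key]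
  omega

/-- The string guiding level `n`. -/
def gs (σs : ℕ → BStr) (n : ℕ) : BStr := σs (stg σs n)

theorem gs_len (σs : ℕ → BStr) (hinc : ∀ s, (σs s).length < (σs (s + 1)).length) (n : ℕ) :
    n ≤ (gs σs n).length := by
  have := stg_spec σs hinc n (stg σs n)
  unfold gs
  omega

theorem gs_lim (σs : ℕ → BStr) (A : ℕ → Bool)
    (hinc : ∀ s, (σs s).length < (σs (s + 1)).length) (happ : RecApprox σs A) (k : ℕ) :
    ∃ N, ∀ n ≥ N, (gs σs n).take k = seg A k := by
  obtain ⟨s0, h⟩ := happ.2 k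
  refine ⟨(σs s0).length + 1, fun n hn => h _ ?_⟩
  have := (stg_spec σs hinc n s0).2 (by omega)
  omega

/-- The symbol chosen after `τ` when following `X`. -/
def sym (G : ℕ → BStr) (X : ℕ → Bool) (τ : List Sym3) : Sym3 :=
  if delB τ = (G τ.length).take (delB τ).length then some (X (delB τ).length) else none

/-- The node at level `n` when following `X`. -/
def node (G : ℕ → BStr) (X : ℕ → Bool) : ℕ → List Sym3
  | 0 => []
  | n + 1 => node G X n ++ [sym G X (node G X n)]

/-- The path following `X`. -/
def pth (G : ℕ → BStr) (X : ℕ → Bool) (n : ℕ) : Sym3 := sym G X (node G X n)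

theorem seg_pth (G : ℕ → BStr) (X : ℕ → Bool) (n : ℕ) : seg (pth G X) n = node G X n := by
  induction n with
  | zero => rfl
  | succ n ih => rw [seg_succ, ih]; rfl

theorem node_length (G : ℕ → BStr) (X : ℕ → Bool) (n : ℕ) : (node G X n).length = n := by
  rw [← seg_pth, seg_length]

theorem node_init (G : ℕ → BStr) (X : ℕ → Bool) (n : ℕ) :
    delB (node G X n) = seg X (delB (node G X n)).length := by
  induction n with
  | zero => rfl
  | succ n ih =>
    rw [node, delB_append, sym]
    split_ifs with h
    · rw [delB_some, List.length_append, List.length_singleton, seg_succ, ← ih]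
    · rw [delB_none, List.append_nil]; exact ih

theorem node_mem (σs : ℕ → BStr) (X : ℕ → Bool) (n : ℕ) : TreeT σs (node (gs σs) X n) := by
  induction n with
  | zero => exact TreeT.nil
  | succ n ih =>
    rw [node]
    refine TreeT.ext _ _ ih ?_
    rw [sym]
    by_cases hc : delB (node (gs σs) X n) <+: gs σs (node (gs σs) X n).length
    · rw [if_pos (by exact hc), if_pos (List.prefix_iff_eq_take.1 hc)]
      exact Option.some_ne_none _
    · rw [if_neg (by exact hc), if_neg (fun h => hc (List.prefix_iff_eq_take.2 h))]

theorem treeT_cond {σs : ℕ → BStr} {τ : List Sym3} {a : Sym3} (h : TreeT σs (τ ++ [a])) :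
    TreeT σs τ ∧ (if delB τ <+: gs σs τ.length then a ≠ none else a = none) := by
  generalize hρ : τ ++ [a] = ρ at h
  cases h with
  | nil => simp at hρ
  | ext τ' a' h1 h2 =>
    obtain ⟨rfl, h⟩ := List.append_inj' hρ rfl
    obtain rfl : a = a' := by simpa using h
    exact ⟨h1, h2⟩

theorem eq_node {σs : ℕ → BStr} {X : ℕ → Bool} {τ : List Sym3} (h : TreeT σs τ)
    (hX : delB τ = seg X (delB τ).length) : τ = node (gs σs) X τ.length := by
  induction h with
  | nil => rfl
  | ext τ a h1 h2 ih =>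
    have hp : delB τ <+: delB (τ ++ [a]) := delB_pre_le (List.prefix_append _ _)
    have ih := ih (init_of_pre_le hp hX)
    rw [List.length_append, List.length_singleton, node, ← ih]
    congr 2
    rw [sym]
    change (if delB τ <+: gs σs τ.length then a ≠ none else a = none) at h2
    split_ifs at h2 with hc
    · rw [if_pos (List.prefix_iff_eq_take.1 hc)]
      obtain ⟨b, rfl⟩ := Option.ne_none_iff_exists'.1 h2
      rw [delB_append, delB_some, List.length_append, List.length_singleton, seg_succ] at hX
      have := (List.append_inj' hX rfl).2
      simpa using this
    · rw [if_neg (fun h => hc (List.prefix_iff_eq_take.2 h))]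
      exact h2

/-- Extend a finite string to a sequence. -/
def ofL (ρ : BStr) (i : ℕ) : Bool := ρ.getD i false

theorem seg_ofL (ρ : BStr) : ρ = seg (ofL ρ) ρ.length := by
  apply List.ext_getElem
  · rw [seg_length]
  · intro i h1 h2
    simp [seg, ofL, h1]

theorem treeT_iff (σs : ℕ → BStr) (τ : List Sym3) :
    TreeT σs τ ↔ τ = node (gs σs) (ofL (delB τ)) τ.length := by
  constructor
  · intro h; exact eq_node h (seg_ofL _)
  · intro h; rw [h]; exact node_mem _ _ _

theorem node_congr (G : ℕ → BStr) (X Y : ℕ → Bool) (n : ℕ) (h : ∀ i < n, X i = Y i) :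
    node G X n = node G Y n := by
  induction n with
  | zero => rfl
  | succ n ih =>
    have := ih (fun i hi => h i (by omega))
    rw [node, node, ← this]
    have hl := delB_length_le (node G X n)
    rw [node_length] at hl
    rw [sym, sym, h _ (by omega)]

theorem pth_congr (G : ℕ → BStr) (X Y : ℕ → Bool) (n : ℕ) (h : ∀ i < n + 1, X i = Y i) :
    pth G X n = pth G Y n := by
  have := node_congr G X Y (n + 1) h
  rw [node, node] at this
  unfold pth
  simpa using (List.append_inj' this rfl).2

theorem mem_isTree (σs : ℕ → BStr) : IsTree {τ : List Sym3 | TreeT σs τ} := by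
  rintro σ τ ⟨t, rfl⟩ h
  induction t using List.reverseRecOn with
  | nil => simpa using h
  | append_singleton t a ih =>
    rw [← List.append_assoc] at h
    exact ih (treeT_cond h).1

theorem eq_pth {σs : ℕ → BStr} {X : ℕ → Bool} {D : ℕ → Sym3}
    (hD : D ∈ paths {τ : List Sym3 | TreeT σs τ})
    (h : ∀ k, delB (seg D k) = seg X (delB (seg D k)).length) : D = pth (gs σs) X := by
  funext n
  have h1 := eq_node (hD (n + 1)) (h (n + 1))
  rw [seg_length, ← seg_pth, seg_succ, seg_succ] at h1
  simpa using (List.append_inj' h1 rfl).2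

theorem pth_mem (σs : ℕ → BStr) (X : ℕ → Bool) :
    pth (gs σs) X ∈ paths {τ : List Sym3 | TreeT σs τ} := by
  intro k
  rw [seg_pth]; exact node_mem _ _ _

theorem delB_const {D : ℕ → Sym3} {k : ℕ} (j : ℕ) (h : ∀ i, k ≤ i → i < k + j → D i = none) :
    delB (seg D (k + j)) = delB (seg D k) := by
  induction j with
  | zero => rfl
  | succ j ih =>
    rw [← Nat.add_assoc, seg_succ, delB_append, h (k + j) (by omega) (by omega), delB_none,
      List.append_nil]
    exact ih (fun i h1 h2 => h i h1 (by omega))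

theorem infinite_eq {A : ℕ → Bool} {σs : ℕ → BStr} {D : ℕ → Sym3}
    (hlim : ∀ k, ∃ N, ∀ n ≥ N, (gs σs n).take k = seg A k)
    (hD : D ∈ paths {τ : List Sym3 | TreeT σs τ}) (hinf : {n : ℕ | D n ≠ none}.Infinite) :
    D = pth (gs σs) A := by
  apply eq_pth hD
  intro k
  obtain ⟨N, hN⟩ := hlim (delB (seg D k)).length
  obtain ⟨n, hn, hgt⟩ := hinf.exists_gt (max k N)
  have h1 := hD (n + 1)
  rw [seg_succ] at h1
  have h2 := (treeT_cond h1).2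
  rw [seg_length] at h2
  split_ifs at h2 with hc
  · have h3 : delB (seg D k) <+: gs σs n :=
      (delB_pre_le (seg_pre_le D (by omega))).trans hc
    rw [← hN n (by omega)]
    exact List.prefix_iff_eq_take.1 h3
  · exact absurd h2 hn

theorem pth_infinite {A : ℕ → Bool} {σs : ℕ → BStr}
    (hlim : ∀ k, ∃ N, ∀ n ≥ N, (gs σs n).take k = seg A k) :
    {n : ℕ | pth (gs σs) A n ≠ none}.Infinite := by
  intro hfin
  obtain ⟨b, hb⟩ := hfin.bddAbove
  obtain ⟨N, hN⟩ := hlim (delB (seg (pth (gs σs) A) (b + 1))).length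
  have hnone : ∀ i, b + 1 ≤ i → pth (gs σs) A i = none := by
    intro i hi
    by_contra hne
    have : i ≤ b := hb hne
    omega
  have h1 := delB_const (D := pth (gs σs) A) (k := b + 1) N (fun i hi _ => hnone i hi)
  have h2 := hnone (b + 1 + N) (by omega)
  rw [seg_pth, seg_pth] at h1
  rw [pth, sym, node_length, h1, ← seg_pth, hN _ (by omega), seg_pth, ← node_init] at h2
  simp at h2

theorem delB_hits {A : ℕ → Bool} {G : ℕ → BStr} (hinf : {n : ℕ | pth G A n ≠ none}.Infinite)
    (n : ℕ) : ∃ k, delB (seg (pth G A) k) = seg A n := by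
  induction n with
  | zero => exact ⟨0, rfl⟩
  | succ n ih =>
    obtain ⟨k, hk⟩ := ih
    have hex : ∃ j, pth G A (k + j) ≠ none := by
      obtain ⟨m, hm, hgt⟩ := hinf.exists_gt k
      refine ⟨m - k, ?_⟩
      rw [Nat.add_sub_cancel' hgt.le]; exact hm
    classical
    have hs := Nat.find_spec hex
    have h1 := delB_const (D := pth G A) (k := k) (Nat.find hex) (by
      intro i h1 h2
      have := Nat.find_min hex (m := i - k) (by omega)
      rw [Nat.add_sub_cancel' h1] at this
      exact not_not.1 this)
    refine ⟨k + Nat.find hex + 1, ?_⟩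
    obtain ⟨b, hb⟩ := Option.ne_none_iff_exists'.1 hs
    have h2 : delB (seg (pth G A) (k + Nat.find hex + 1)) = seg A n ++ [b] := by
      rw [seg_succ, delB_append, hb, h1, hk, delB_some]
    have h3 := node_init G A (k + Nat.find hex + 1)
    rw [← seg_pth, h2, List.length_append, seg_length, List.length_singleton] at h3
    rw [h2, h3]

theorem paths_infinite {A : ℕ → Bool} {σs : ℕ → BStr}
    (hinf : {n : ℕ | pth (gs σs) A n ≠ none}.Infinite) :
    (paths {τ : List Sym3 | TreeT σs τ}).Infinite := by
  classical
  set C := pth (gs σs) A with hC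
  refine Set.Infinite.of_image
    (fun D => if h : ∃ n, D n ≠ C n then Nat.find h else 0) (hinf.mono ?_)
  intro n hn
  obtain ⟨b, hb⟩ := Option.ne_none_iff_exists'.1 hn
  have h1 : TreeT σs (seg C (n + 1)) := pth_mem σs A (n + 1)
  rw [seg_succ] at h1
  obtain ⟨h2, h3⟩ := treeT_cond h1
  have h4 : TreeT σs (seg C n ++ [some (!b)]) := by
    refine TreeT.ext _ _ h2 ?_
    split_ifs at h3 with hc
    · rw [if_pos (by exact hc)]; simp
    · exact absurd h3 hn
  have h5 := (treeT_iff σs _).1 h4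
  rw [← seg_pth, List.length_append, List.length_singleton, seg_length] at h5
  set D := pth (gs σs) (ofL (delB (seg C n ++ [some (!b)]))) with hD
  rw [seg_succ] at h5
  obtain ⟨h6, h7⟩ := List.append_inj' h5 rfl
  have hne : D n ≠ C n := by
    have : some (!b) = D n := by simpa using h7
    rw [← this, hb]; simp
  have hlt : ∀ i < n, D i = C i := by
    intro i hi
    have a1 := seg_getElem? C hi
    rw [h6, seg_getElem? D hi] at a1
    simpa using a1
  refine ⟨D, pth_mem _ _, ?_⟩
  have hex : ∃ n, D n ≠ C n := ⟨n, hne⟩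
  simp only [dif_pos hex]
  rw [Nat.find_eq_iff]
  exact ⟨hne, fun m hm => not_not.2 (hlt m hm)⟩

theorem stg_comp (σs : ℕ → BStr) (hinc : ∀ s, (σs s).length < (σs (s + 1)).length)
    (hc : Computable σs) : Computable (stg σs) := by
  have h : Computable (fun n : ℕ => Nat.rec (motive := fun _ => ℕ) 0
      (fun s acc => bif decide ((σs s).length + 1 ≤ n) then acc + 1 else acc) (n + 2)) := by
    refine Computable.nat_rec
      (h := fun n (p : ℕ × ℕ) => bif decide ((σs p.1).length + 1 ≤ n) then p.2 + 1 else p.2)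
      (Computable.succ.comp Computable.succ) (Computable.const 0) ?_
    refine Computable.cond ?_ ?_ ?_
    · exact (Primrec.nat_le.decide.to_comp).comp
        (Computable.succ.comp (Computable.list_length.comp
          (hc.comp (Computable.fst.comp Computable.snd)))) Computable.fst
    · exact Computable.succ.comp (Computable.snd.comp Computable.snd)
    · exact Computable.snd.comp Computable.snd
  refine h.of_eq fun n => ?_
  rw [stg_eq σs hinc]
  generalize n + 2 = N
  induction N with
  | zero => rfl
  | succ N ih =>
    rw [Nat.count_succ, ← ih]
    by_cases h : (σs N).length + 1 ≤ n <;> simp [h]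

theorem delB_comp : Computable delB :=
  (Primrec.listFilterMap (f := fun l : List Sym3 => l) (g := fun _ a => a)
    Primrec.id Primrec.snd).to_comp

theorem sym_comp {G : ℕ → BStr} (hG : Computable G) :
    Computable₂ (fun (ρ : BStr) (τ : List Sym3) => sym G (ofL ρ) τ) := by
  have hd : Computable (fun p : BStr × List Sym3 => delB p.2) := delB_comp.comp Computable.snd
  have hl : Computable (fun p : BStr × List Sym3 => (delB p.2).length) :=
    Computable.list_length.comp hd
  have h : Computable (fun p : BStr × List Sym3 =>
      bif decide (delB p.2 = (G p.2.length).take (delB p.2).length)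
      then some (p.1.getD (delB p.2).length false) else none) := by
    refine Computable.cond ?_ ?_ (Computable.const _)
    · exact (Primrec.eq.decide.to_comp).comp hd
        ((Primrec.list_take.to_comp).comp hl
          (hG.comp (Computable.list_length.comp Computable.snd)))
    · exact Computable.option_some.comp
        (((Primrec.list_getD false).to_comp).comp Computable.fst hl)
  refine h.of_eq fun p => ?_
  simp [sym, ofL, Bool.cond_decide]

theorem node_comp {G : ℕ → BStr} (hG : Computable G) :
    Computable₂ (fun (ρ : BStr) (n : ℕ) => node G (ofL ρ) n) := by
  have h : Computable (fun p : BStr × ℕ => Nat.rec (motive := fun _ => List Sym3) []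
      (fun _ τ => τ ++ [sym G (ofL p.1) τ]) p.2) := by
    refine Computable.nat_rec
      (h := fun (p : BStr × ℕ) (q : ℕ × List Sym3) => q.2 ++ [sym G (ofL p.1) q.2])
      Computable.snd (Computable.const []) ?_
    exact Computable.list_concat.comp (Computable.snd.comp Computable.snd)
      ((sym_comp hG).comp (Computable.fst.comp Computable.fst)
        (Computable.snd.comp Computable.snd))
  refine h.of_eq fun p => ?_
  obtain ⟨ρ, n⟩ := p
  change _ = node G (ofL ρ) n
  induction n with
  | zero => rfl
  | succ n ih => rw [node, ← ih]

/-- The functional computing the path from the sequence. -/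
def fwd {G : ℕ → BStr} (hG : Computable G) : Functional Bool Sym3 where
  φ ρ x := bif decide (x < ρ.length) then some (pth G (ofL ρ) x) else none
  comp := by
    refine Computable.cond (c := fun p : BStr × ℕ => decide (p.2 < p.1.length)) ?_ ?_
      (Computable.const _)
    · exact (Primrec.nat_lt.decide.to_comp).comp Computable.snd
        (Computable.list_length.comp Computable.fst)
    · exact Computable.option_some.comp
        ((sym_comp hG).comp Computable.fst (node_comp hG))
  mono := by
    intro σ τ x b h hx
    by_cases hl : x < σ.length
    · have hl2 : x < τ.length := lt_of_lt_of_le hl h.length_le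
      simp only [hl, hl2, decide_true, cond_true] at hx ⊢
      rw [← hx]
      congr 1
      apply pth_congr
      intro i hi
      obtain ⟨t, rfl⟩ := h
      have : i < σ.length := by omega
      simp [ofL, List.getElem?_append_left this]
    · simp [hl] at hx

/-- The functional deleting blanks. -/
def bwd : Functional Sym3 Bool where
  φ τ x := (delB τ)[x]?
  comp := Computable.list_getElem?.comp (delB_comp.comp Computable.fst) Computable.snd
  mono := by
    intro σ τ x b h hx
    obtain ⟨t, ht⟩ := delB_pre_le h
    have hl : x < (delB σ).length := by
      by_contra hn
      rw [List.getElem?_eq_none (by omega)] at hx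
      cases hx
    rw [← ht, List.getElem?_append_left hl]
    exact hx

end TreeAux


/-- the constructed tree `T` is recursive, every string of `T` is
extendible, `[T]` is infinite, `T` has a unique path `C` with infinitely many non-`B`
symbols, and every such path satisfies `C^d = A` and `C ≡_T A`. -/
theorem treeT_basic_properties (A : ℕ → Bool) (σs : ℕ → BStr) (hA : OneGeneric A)
    (hle : TuringLE A K) (hlt : ¬ TuringLE K A)
    (happ : RecApprox σs A) (hcor : SigmaOneCorrect σs A)
    (hinc : ∀ s, (σs s).length < (σs (s + 1)).length) :
    RecTree {τ : List Sym3 | TreeT σs τ} ∧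
    ExtendibleTree {τ : List Sym3 | TreeT σs τ} ∧
    (paths {τ : List Sym3 | TreeT σs τ}).Infinite ∧
    (∃! C : ℕ → Sym3, C ∈ paths {τ : List Sym3 | TreeT σs τ} ∧
        {n : ℕ | C n ≠ none}.Infinite) ∧
    (∀ C : ℕ → Sym3, C ∈ paths {τ : List Sym3 | TreeT σs τ} →
        {n : ℕ | C n ≠ none}.Infinite →
        (∀ n : ℕ, ∃ k : ℕ, delB (seg C k) = seg A n) ∧ TuringEquiv C A) := by
  have hlim := TreeAux.gs_lim σs A hinc happ
  have hG : Computable (TreeAux.gs σs) := happ.1.comp (TreeAux.stg_comp σs hinc happ.1)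
  have hinf := TreeAux.pth_infinite hlim
  refine ⟨⟨TreeAux.mem_isTree σs, ?_⟩, ?_, TreeAux.paths_infinite hinf, ?_, ?_⟩
  · refine ⟨fun τ => decide
      (τ = TreeAux.node (TreeAux.gs σs) (TreeAux.ofL (delB τ)) τ.length), ?_, ?_⟩
    · exact (Primrec.eq.decide.to_comp).comp Computable.id
        ((TreeAux.node_comp hG).comp TreeAux.delB_comp Computable.list_length)
    · intro τ
      rw [decide_eq_true_iff]
      exact TreeAux.treeT_iff σs τ
  · intro τ hτ
    have h := (TreeAux.treeT_iff σs τ).1 hτ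
    refine ⟨TreeAux.node (TreeAux.gs σs) (TreeAux.ofL (delB τ)) (τ.length + 1),
      TreeAux.node_mem _ _ _, ?_, ?_⟩
    · rw [TreeAux.node, ← h]; exact List.prefix_append _ _
    · intro he
      have := congrArg List.length he
      rw [TreeAux.node_length] at this
      omega
  · exact ⟨TreeAux.pth (TreeAux.gs σs) A, ⟨TreeAux.pth_mem σs A, hinf⟩,
      fun D hD => TreeAux.infinite_eq hlim hD.1 hD.2⟩
  · intro C hC hCinf
    obtain rfl := TreeAux.infinite_eq hlim hC hCinf
    refine ⟨TreeAux.delB_hits hinf, ⟨TreeAux.fwd hG, ?_⟩, ⟨TreeAux.bwd, ?_⟩⟩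
    · intro x
      refine ⟨x + 1, ?_⟩
      have hx : x < (seg A (x + 1)).length := by rw [TreeAux.seg_length]; omega
      simp only [TreeAux.fwd, hx, decide_true, cond_true]
      congr 1
      apply TreeAux.pth_congr
      intro i hi
      simp only [TreeAux.ofL, List.getD_eq_getElem?_getD, TreeAux.seg_getElem? A hi,
        Option.getD_some]
    · intro x
      obtain ⟨k, hk⟩ := TreeAux.delB_hits hinf (x + 1)
      refine ⟨k, ?_⟩
      simp only [TreeAux.bwd, hk]
      exact TreeAux.seg_getElem? A (by omega)
end
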